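/- arXiv:2403.09546 — 2 statements merged into one kernel-verified Lean document; each statement's English description precedes it below -/
import Mathlib

section
/- Let X be a Hausdorff topological space equipped with a lower semicontinuous metric d (not necessarily compatible with the topology), and let π be a Radon measure on X × X concentrated on a d-cyclically monotonic set. Then π is concentrated on a set admitting a Borel d-extremal function, i.e., a Borel 1-d-Lipschitz function f : X → ℝ satisfying f(x) - f(y) = d(x,y) on that set. -/
open MeasureTheory

/-- A set `C ⊆ X × X` is `d`-cyclically monotonic if for all
`(x_1,y_1), …, (x_n,y_n) ∈ C` and every permutation `σ` of `{1,…,n}`,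
`Σ d(x_k,y_k) ≤ Σ d(x_k, y_{σ(k)})`. -/
def IsCyclicallyMonotonic {X : Type*} (d : X → X → ℝ) (C : Set (X × X)) : Prop :=
  ∀ (n : ℕ) (p : Fin n → X × X), (∀ i, p i ∈ C) → ∀ σ : Equiv.Perm (Fin n),
    ∑ i, d (p i).1 (p i).2 ≤ ∑ i, d (p i).1 (p (σ i)).2


open MeasureTheory Set Filter Topology
open scoped ENNReal

section ChainPart

/-- cost of a path `z → x₁ → y₁ → ... → w`. -/
noncomputable def pathCost {X : Type*} (d : X → X → ℝ) : X → List (X × X) → X → ℝ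
  | z, [], w => d z w
  | z, p :: l, w => d z p.1 - d p.1 p.2 + pathCost d p.2 l w

variable {X : Type*} {d : X → X → ℝ}

lemma pathCost_lip (hd_tri : ∀ x y z, d x z ≤ d x y + d y z) (l : List (X × X)) (z w w' : X) :
    pathCost d z l w ≤ pathCost d z l w' + d w' w := by
  induction l generalizing z with
  | nil => exact hd_tri _ _ _
  | cons p l ih => simp only [pathCost]; linarith [ih p.2]

lemma pathCost_append (l : List (X × X)) (p : X × X) (z w : X) :
    pathCost d z (l ++ [p]) w = pathCost d z l p.1 - d p.1 p.2 + d p.2 w := by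
  induction l generalizing z with
  | nil => simp [pathCost]
  | cons q l ih => simp only [pathCost, List.cons_append, ih]; ring

lemma pathCost_ofFn (n : ℕ) (p : Fin (n+1) → X × X) (z w : X) :
    pathCost d z (List.ofFn p) w = d z (p 0).1 - ∑ i, d (p i).1 (p i).2
      + ∑ i : Fin n, d (p i.castSucc).2 (p i.succ).1 + d (p (Fin.last n)).2 w := by
  induction n generalizing z with
  | zero => simp [pathCost]
  | succ n ih =>
    rw [List.ofFn_succ]
    simp only [pathCost]
    rw [ih (fun i => p i.succ), Fin.sum_univ_succ (fun i => d (p i).1 (p i).2),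
      Fin.sum_univ_succ (fun i : Fin (n+1) => d (p i.castSucc).2 (p i.succ).1)]
    simp only [Fin.succ_last, Fin.castSucc_zero, Fin.succ_castSucc]
    ring

lemma pathCost_lower (hd_eq : ∀ x y, d x y = 0 ↔ x = y) (hd_symm : ∀ x y, d x y = d y x)
    (hd_tri : ∀ x y z, d x z ≤ d x y + d y z) {S : Set (X × X)}
    (hS : IsCyclicallyMonotonic d S) (l : List (X × X)) (hl : ∀ p ∈ l, p ∈ S) (z w : X) :
    - d z w ≤ pathCost d z l w := by
  have hnn : ∀ x y, 0 ≤ d x y := fun x y => by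
    have := hd_tri x y x
    rw [(hd_eq x x).2 rfl, hd_symm y x] at this; linarith
  rcases l with _ | ⟨q, l⟩
  · simp only [pathCost]; linarith [hnn z w]
  · obtain ⟨n, p, hp⟩ : ∃ n, ∃ p : Fin (n+1) → X × X, List.ofFn p = q :: l :=
      ⟨l.length, (q :: l).get, List.ofFn_get _⟩
    rw [← hp] at hl ⊢
    have hpS : ∀ i, p i ∈ S := fun i => hl _ ((List.mem_ofFn' _ _).2 ⟨i, rfl⟩)
    rw [pathCost_ofFn]
    have h1 := hS _ p hpS (finRotate (n+1)).symm
    have h2 : ∑ i, d (p i).1 (p ((finRotate (n+1)).symm i)).2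
        = ∑ i : Fin n, d (p i.castSucc).2 (p i.succ).1 + d (p (Fin.last n)).2 (p 0).1 := by
      rw [← Equiv.sum_comp (finRotate (n+1))]
      rw [Fin.sum_univ_castSucc]
      simp only [Equiv.symm_apply_apply, finRotate_last]
      rw [hd_symm (p 0).1]
      congr 1
      refine Finset.sum_congr rfl fun i _ => ?_
      rw [hd_symm, finRotate_apply, Fin.coeSucc_eq_succ]
    rw [h2] at h1
    have h3 := hd_tri (p (Fin.last n)).2 w (p 0).1
    have h4 := hd_tri w z (p 0).1
    have h5 := hd_symm w z
    linarith

/-- the chain potential -/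
noncomputable def chainFun (d : X → X → ℝ) (S : Set (X × X)) (z w : X) : ℝ :=
  ⨅ l : {l : List (X × X) // ∀ p ∈ l, p ∈ S}, pathCost d z l.1 w

lemma chainFun_spec (hd_eq : ∀ x y, d x y = 0 ↔ x = y) (hd_symm : ∀ x y, d x y = d y x)
    (hd_tri : ∀ x y z, d x z ≤ d x y + d y z) {S : Set (X × X)}
    (hS : IsCyclicallyMonotonic d S) (z : X) :
    (∀ x y, |chainFun d S z x - chainFun d S z y| ≤ d x y) ∧
    (∀ p ∈ S, chainFun d S z p.1 - chainFun d S z p.2 = d p.1 p.2) ∧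
    (∀ w a, chainFun d S z w < a ↔ ∃ l : List (X × X), (∀ p ∈ l, p ∈ S) ∧ pathCost d z l w < a) := by
  have : Nonempty {l : List (X × X) // ∀ p ∈ l, p ∈ S} := ⟨⟨[], by simp⟩⟩
  have hb : ∀ w, BddBelow (range fun l : {l : List (X × X) // ∀ p ∈ l, p ∈ S} =>
      pathCost d z l.1 w) := fun w => ⟨- d z w, by
    rintro _ ⟨l, rfl⟩
    exact pathCost_lower hd_eq hd_symm hd_tri hS l.1 l.2 z w⟩
  have hlip : ∀ x y, chainFun d S z x - d y x ≤ chainFun d S z y := fun x y => by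
    refine le_ciInf fun l => ?_
    have := ciInf_le (hb x) l
    have h2 := pathCost_lip hd_tri l.1 z x y
    unfold chainFun
    linarith
  have habs : ∀ x y, |chainFun d S z x - chainFun d S z y| ≤ d x y := fun x y => by
    rw [abs_le]
    have h1 := hlip x y
    have h2 := hlip y x
    rw [hd_symm y x] at h1
    constructor <;> linarith
  refine ⟨habs, fun p hp => ?_, fun w a => ?_⟩
  · apply le_antisymm ((le_abs_self _).trans (habs _ _))
    have : chainFun d S z p.2 + d p.1 p.2 ≤ chainFun d S z p.1 := by
      refine le_ciInf fun l => ?_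
      have := ciInf_le (hb p.2) ⟨l.1 ++ [p], by
        intro q hq
        rcases List.mem_append.1 hq with h | h
        · exact l.2 q h
        · rw [List.mem_singleton.1 h]; exact hp⟩
      rw [pathCost_append, (hd_eq p.2 p.2).2 rfl] at this
      unfold chainFun
      linarith
    linarith
  · unfold chainFun
    rw [ciInf_lt_iff (hb w)]
    simp

variable [TopologicalSpace X]

lemma pathCost_lsc (hd_lsc : LowerSemicontinuous fun p : X × X => d p.1 p.2)
    (n : ℕ) (K : Fin n → Set (X × X))
    (hK : ∀ i, LowerSemicontinuousOn (fun p : X × X => - d p.1 p.2) (K i)) :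
    LowerSemicontinuousOn (fun q : X × (Fin n → X × X) × X => pathCost d q.1 (List.ofFn q.2.1) q.2.2)
      {q | ∀ i, q.2.1 i ∈ K i} := by
  induction n with
  | zero =>
    simp only [List.ofFn_zero, pathCost]
    exact (hd_lsc.comp (g := fun q : X × (Fin 0 → X × X) × X => (q.1, q.2.2))
      (by fun_prop)).lowerSemicontinuousOn _
  | succ n ih =>
    simp only [List.ofFn_succ, pathCost, sub_eq_add_neg]
    refine LowerSemicontinuousOn.add (LowerSemicontinuousOn.add ?_ ?_) ?_
    · exact (hd_lsc.comp (g := fun q : X × (Fin (n+1) → X × X) × X => (q.1, (q.2.1 0).1))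
        (by fun_prop)).lowerSemicontinuousOn _
    · exact (hK 0).comp (g := fun q : X × (Fin (n+1) → X × X) × X => q.2.1 0)
        (by fun_prop) (fun q hq => hq 0)
    · exact LowerSemicontinuousOn.comp (t := {q | ∀ i, q.2.1 i ∈ K i})
        (ih (fun i => K i.succ) (fun i => hK _))
        (g := fun q : X × (Fin (n+1) → X × X) × X => ((q.2.1 0).2, (fun i => q.2.1 i.succ), q.2.2))
        (by fun_prop) (fun q hq i => hq i.succ)

lemma isClosed_sublevel [T2Space X] (hd_lsc : LowerSemicontinuous fun p : X × X => d p.1 p.2)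
    (n : ℕ) (K : Fin n → Set (X × X)) (hKc : ∀ i, IsCompact (K i))
    (hK : ∀ i, LowerSemicontinuousOn (fun p : X × X => - d p.1 p.2) (K i)) (z : X) (b : ℝ) :
    IsClosed {w | ∃ p : Fin n → X × X, (∀ i, p i ∈ K i) ∧ pathCost d z (List.ofFn p) w ≤ b} := by
  have h := lowerSemicontinuousOn_iff_preimage_Iic.1 (pathCost_lsc hd_lsc n K hK) b
  obtain ⟨v, hv, hv2⟩ := h
  have hc : IsCompact {p : Fin n → X × X | ∀ i, p i ∈ K i} := isCompact_pi_infinite hKc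
  have := isCompact_iff_compactSpace.1 hc
  let φ : ({p : Fin n → X × X | ∀ i, p i ∈ K i}) × X → X × (Fin n → X × X) × X :=
    fun q => (z, q.1.1, q.2)
  have hφ : Continuous φ := by fun_prop
  have h2 := isClosedMap_snd_of_compactSpace _ (hv.preimage hφ)
  convert h2 using 1
  ext w
  constructor
  · rintro ⟨p, hp, hpb⟩
    refine ⟨(⟨p, hp⟩, w), ?_, rfl⟩
    have : (z, p, w) ∈ {q : X × (Fin n → X × X) × X | ∀ i, q.2.1 i ∈ K i} ∩ v := by
      rw [← hv2]; exact ⟨hp, hpb⟩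
    exact this.2
  · rintro ⟨⟨⟨p, hp⟩, w'⟩, hpv, rfl⟩
    have : (z, p, w') ∈ {q : X × (Fin n → X × X) × X | ∀ i, q.2.1 i ∈ K i} ∩ v := ⟨hp, hpv⟩
    rw [← hv2] at this
    exact ⟨p, hp, this.2⟩

lemma chainFun_measurable [T2Space X] [MeasurableSpace X] [BorelSpace X]
    (hd_eq : ∀ x y, d x y = 0 ↔ x = y) (hd_symm : ∀ x y, d x y = d y x)
    (hd_tri : ∀ x y z, d x z ≤ d x y + d y z)
    (hd_lsc : LowerSemicontinuous fun p : X × X => d p.1 p.2)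
    (K : ℕ → Set (X × X)) (hKc : ∀ i, IsCompact (K i))
    (hK : ∀ i, LowerSemicontinuousOn (fun p : X × X => - d p.1 p.2) (K i))
    (hS : IsCyclicallyMonotonic d (⋃ n, K n)) (z : X) :
    Measurable (chainFun d (⋃ n, K n) z) := by
  refine measurable_of_Iio fun a => ?_
  have : chainFun d (⋃ n, K n) z ⁻¹' Iio a = ⋃ (q : {q : ℚ // (q : ℝ) < a}),
      ⋃ (m : Σ n : ℕ, (Fin n → ℕ)), {w | ∃ p : Fin m.1 → X × X, (∀ i, p i ∈ K (m.2 i)) ∧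
        pathCost d z (List.ofFn p) w ≤ (q.1 : ℝ)} := by
    ext w
    simp only [mem_preimage, mem_Iio, mem_iUnion]
    rw [(chainFun_spec hd_eq hd_symm hd_tri hS z).2.2 w a]
    constructor
    · rintro ⟨l, hl, hla⟩
      obtain ⟨q, hq1, hq2⟩ := exists_rat_btwn hla
      have : ∀ i : Fin l.length, ∃ n, l.get i ∈ K n := fun i => mem_iUnion.1 (hl _ (l.get_mem i))
      choose m hm using this
      exact ⟨⟨q, hq2⟩, ⟨l.length, m⟩, l.get, hm, by rw [List.ofFn_get]; exact hq1.le⟩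
    · rintro ⟨q, m, p, hp, hpq⟩
      refine ⟨List.ofFn p, fun r hr => ?_, hpq.trans_lt q.2⟩
      obtain ⟨i, rfl⟩ := (List.mem_ofFn' _ _).1 hr
      exact mem_iUnion.2 ⟨_, hp i⟩
  rw [this]
  exact MeasurableSet.iUnion fun q => MeasurableSet.iUnion fun m =>
    (isClosed_sublevel hd_lsc m.1 _ (fun i => hKc _) (fun i => hK _) z _).measurableSet

end ChainPart
section MeasurePart

variable {X : Type*} [MeasurableSpace X]

lemma exists_saturating {E : Set (X × X)} (hE : MeasurableSet E) :
    ∃ A : ℕ → Set X, (∀ n, MeasurableSet (A n)) ∧ ∀ x x' y y', (∀ n, x ∈ A n ↔ x' ∈ A n) →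
      (∀ n, y ∈ A n ↔ y' ∈ A n) → ((x, y) ∈ E ↔ (x', y') ∈ E) := by
  refine MeasurableSpace.induction_on_inter (C := fun E _ => ∃ A : ℕ → Set X,
    (∀ n, MeasurableSet (A n)) ∧ ∀ x x' y y', (∀ n, x ∈ A n ↔ x' ∈ A n) →
      (∀ n, y ∈ A n ↔ y' ∈ A n) → ((x, y) ∈ E ↔ (x', y') ∈ E))
    generateFrom_prod.symm isPiSystem_prod ?_ ?_ ?_ ?_ E hE
  · exact ⟨fun _ => ∅, fun _ => .empty, by simp⟩
  · rintro _ ⟨s, hs, t, ht, rfl⟩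
    refine ⟨fun n => if n = 0 then s else t, fun n => ?_, fun x x' y y' h1 h2 => ?_⟩
    · dsimp only; split_ifs
      exacts [hs, ht]
    · have a := h1 0
      have b := h2 1
      simp only [if_true, one_ne_zero, if_false] at a b
      simp [mem_prod, a, b]
  · rintro t _ ⟨A, hA, h⟩
    exact ⟨A, hA, fun x x' y y' h1 h2 => not_congr (h x x' y y' h1 h2)⟩
  · rintro f _ _ h
    choose A hA h using h
    refine ⟨fun n => A n.unpair.1 n.unpair.2, fun n => hA _ _, fun x x' y y' h1 h2 => ?_⟩
    simp only [mem_iUnion]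
    refine exists_congr fun i => h i x x' y y' (fun n => ?_) (fun n => ?_)
    · simpa using h1 (Nat.pair i n)
    · simpa using h2 (Nat.pair i n)

variable [TopologicalSpace X] [BorelSpace X]

lemma exists_open_meas_between {L U : Set (X × X)} (hL : IsCompact L) (hU : IsOpen U)
    (hLU : L ⊆ U) : ∃ V, IsOpen V ∧ MeasurableSet V ∧ L ⊆ V ∧ V ⊆ U := by
  refine hL.induction_on (p := fun L => ∃ V, IsOpen V ∧ MeasurableSet V ∧ L ⊆ V ∧ V ⊆ U)
    ⟨∅, isOpen_empty, .empty, Subset.rfl, empty_subset _⟩ ?_ ?_ ?_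
  · rintro s t hst ⟨V, h1, h2, h3, h4⟩
    exact ⟨V, h1, h2, hst.trans h3, h4⟩
  · rintro s t ⟨V, h1, h2, h3, h4⟩ ⟨V', h1', h2', h3', h4'⟩
    exact ⟨V ∪ V', h1.union h1', h2.union h2', union_subset_union h3 h3', union_subset h4 h4'⟩
  · rintro ⟨x, y⟩ hx
    obtain ⟨u, v, hu, hv, hxu, hyv, huv⟩ := isOpen_prod_iff.1 hU x y (hLU hx)
    exact ⟨u ×ˢ v, mem_nhdsWithin_of_mem_nhds ((hu.prod hv).mem_nhds ⟨hxu, hyv⟩),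
      u ×ˢ v, hu.prod hv, hu.measurableSet.prod hv.measurableSet, Subset.rfl, huv⟩

variable [T2Space X] (π : Measure (X × X)) [IsFiniteMeasure π] [π.InnerRegular]

lemma exists_open_approx {L : Set (X × X)} (hL : IsCompact L) {ε : ℝ≥0∞} (hε : ε ≠ 0) :
    ∃ V, IsOpen V ∧ MeasurableSet V ∧ L ⊆ V ∧ π V ≤ π L + ε := by
  have hH := measurableSet_toMeasurable π L
  obtain ⟨N, hN, hNc, hNm⟩ := hH.compl.exists_isCompact_lt_add (measure_ne_top π _) hε
  obtain ⟨V, hV, hVm, hLV, hVN⟩ := exists_open_meas_between hL hNc.isClosed.isOpen_compl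
    (fun x hx hxN => hN hxN (subset_toMeasurable π L hx))
  refine ⟨V, hV, hVm, hLV, ?_⟩
  have h1 : π V + π N ≤ π univ := by
    rw [← measure_add_measure_compl hVm]
    gcongr
    exact fun x hx hxV => hVN hxV hx
  have h2 : π univ = π L + π (toMeasurable π L)ᶜ := by
    rw [← measure_add_measure_compl hH, measure_toMeasurable]
  have h3 : π V + π N ≤ (π L + ε) + π N := by
    calc π V + π N ≤ π L + π (toMeasurable π L)ᶜ := h2 ▸ h1
      _ ≤ π L + (π N + ε) := by gcongr
      _ = _ := by ring
  exact (ENNReal.add_le_add_iff_right (measure_ne_top π N)).1 h3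

/-- sets that can be made clopen on compacts of nearly full measure. -/
def GoodSet (E : Set (X × X)) : Prop :=
  ∀ K, IsCompact K → ∀ ε : ℝ≥0∞, ε ≠ 0 → ∃ K', K' ⊆ K ∧ IsCompact K' ∧ IsCompact (K' ∩ E) ∧
    IsCompact (K' \ E) ∧ π K ≤ π K' + ε

lemma goodSet_open {U : Set (X × X)} (hU : IsOpen U) : GoodSet π U := by
  intro K hK ε hε
  have hM : IsCompact (K \ U) := hK.diff hU
  obtain ⟨V, hV, hVm, hMV, hVle⟩ := exists_open_approx π hM hε
  have hL : IsCompact (K \ V) := hK.diff hV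
  have e1 : ((K \ V) ∪ (K \ U)) ∩ U = K \ V := by
    ext x; simp only [mem_inter_iff, mem_union, Set.mem_sdiff]
    constructor
    · tauto
    · rintro ⟨h1, h2⟩
      exact ⟨Or.inl ⟨h1, h2⟩, by by_contra h; exact h2 (hMV ⟨h1, h⟩)⟩
  have e2 : ((K \ V) ∪ (K \ U)) \ U = K \ U := by
    ext x; simp only [mem_union, Set.mem_sdiff]; tauto
  refine ⟨(K \ V) ∪ (K \ U), union_subset sdiff_subset sdiff_subset, hL.union hM, by rwa [e1],
    by rwa [e2], ?_⟩
  have h1 := measure_inter_add_sdiff (μ := π) ((K \ V) ∪ (K \ U)) hVm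
  have e3 : ((K \ V) ∪ (K \ U)) ∩ V = K \ U := by
    ext x; simp only [mem_inter_iff, mem_union, Set.mem_sdiff]
    have := @hMV x
    simp only [Set.mem_sdiff] at this
    tauto
  have e4 : ((K \ V) ∪ (K \ U)) \ V = K \ V := by
    ext x; simp only [mem_union, Set.mem_sdiff]; tauto
  rw [e3, e4] at h1
  calc π K = π (K ∩ V) + π (K \ V) := (measure_inter_add_sdiff K hVm).symm
    _ ≤ (π (K \ U) + ε) + π (K \ V) := by
      gcongr
      exact (measure_mono inter_subset_right).trans hVle
    _ = _ := by rw [← h1]; ring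

lemma goodSet_preimage {φ : X × X → X} (hφ : Continuous φ) (hφm : Measurable φ) {A : Set X}
    (hA : MeasurableSet A) : GoodSet π (φ ⁻¹' A) := by
  have key : ∀ A : Set X, MeasurableSet A → ∀ ε : ℝ≥0∞, ε ≠ 0 → ∃ L ⊆ A, IsCompact L ∧
      π (φ ⁻¹' A \ φ ⁻¹' L) ≤ ε := by
    intro A hA ε hε
    obtain ⟨N, hN, hNc, hNm⟩ := (hφm hA).exists_isCompact_lt_add (measure_ne_top π _) hε
    have hLc := hNc.image hφ
    refine ⟨φ '' N, image_subset_iff.2 hN, hLc, ?_⟩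
    have h1 := measure_inter_add_sdiff (μ := π) (φ ⁻¹' A) (hφm hLc.measurableSet)
    have h2 : π N ≤ π (φ ⁻¹' A ∩ φ ⁻¹' (φ '' N)) :=
      measure_mono (subset_inter hN (subset_preimage_image _ _))
    have h3 : π N + π (φ ⁻¹' A \ φ ⁻¹' (φ '' N)) ≤ π N + ε := by
      calc _ ≤ π (φ ⁻¹' A) := by rw [← h1]; gcongr
        _ ≤ _ := hNm.le
    exact (ENNReal.add_le_add_iff_left (measure_ne_top π N)).1 h3
  intro K hK ε hε
  have hε2 : ε / 2 ≠ 0 := (ENNReal.half_pos hε).ne'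
  obtain ⟨L, hLA, hL, hLm⟩ := key A hA _ hε2
  obtain ⟨M, hMA, hM, hMm⟩ := key Aᶜ hA.compl _ hε2
  have hLK : IsCompact (K ∩ φ ⁻¹' L) := hK.inter_right (hL.isClosed.preimage hφ)
  have hMK : IsCompact (K ∩ φ ⁻¹' M) := hK.inter_right (hM.isClosed.preimage hφ)
  have e1 : ((K ∩ φ ⁻¹' L) ∪ (K ∩ φ ⁻¹' M)) ∩ φ ⁻¹' A = K ∩ φ ⁻¹' L := by
    ext x; simp only [mem_inter_iff, mem_union, mem_preimage]
    have := @hLA (φ x); have := @hMA (φ x); simp only [mem_compl_iff] at this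
    tauto
  have e2 : ((K ∩ φ ⁻¹' L) ∪ (K ∩ φ ⁻¹' M)) \ φ ⁻¹' A = K ∩ φ ⁻¹' M := by
    ext x; simp only [mem_inter_iff, mem_union, mem_preimage, Set.mem_sdiff]
    have := @hLA (φ x); have := @hMA (φ x); simp only [mem_compl_iff] at this
    tauto
  refine ⟨(K ∩ φ ⁻¹' L) ∪ (K ∩ φ ⁻¹' M), union_subset inter_subset_left inter_subset_left,
    hLK.union hMK, by rwa [e1], by rwa [e2], ?_⟩
  have hsub : K ⊆ ((K ∩ φ ⁻¹' L) ∪ (K ∩ φ ⁻¹' M)) ∪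
      ((φ ⁻¹' A \ φ ⁻¹' L) ∪ (φ ⁻¹' Aᶜ \ φ ⁻¹' M)) := by
    intro x hx
    simp only [mem_inter_iff, mem_union, mem_preimage, Set.mem_sdiff, mem_compl_iff]
    tauto
  calc π K ≤ π ((K ∩ φ ⁻¹' L) ∪ (K ∩ φ ⁻¹' M)) +
        (π (φ ⁻¹' A \ φ ⁻¹' L) + π (φ ⁻¹' Aᶜ \ φ ⁻¹' M)) :=
      (measure_mono hsub).trans ((measure_union_le _ _).trans
        (by gcongr; exact measure_union_le _ _))
    _ ≤ _ + (ε / 2 + ε / 2) := by gcongr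
    _ = _ := by rw [ENNReal.add_halves]

lemma goodSet_seq (E : ℕ → Set (X × X)) (hE : ∀ n, GoodSet π (E n)) {K : Set (X × X)}
    (hK : IsCompact K) {ε : ℝ≥0∞} (hε : ε ≠ 0) :
    ∃ K' ⊆ K, IsCompact K' ∧ (∀ n, IsCompact (K' ∩ E n) ∧ IsCompact (K' \ E n)) ∧
      π K ≤ π K' + ε := by
  have hε2 : ε / 2 ≠ 0 := (ENNReal.half_pos hε).ne'
  obtain ⟨δ, hδ, hδs⟩ := ENNReal.exists_pos_sum_of_countable' hε2 ℕ
  choose! R hR1 hR2 hR3 hR4 hR5 using hE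
  let Ks : ℕ → Set (X × X) := fun n => Nat.rec K (fun n L => R n L (δ n)) n
  have hs : ∀ n, Ks (n+1) = R n (Ks n) (δ n) := fun n => rfl
  have hc : ∀ n, IsCompact (Ks n) := by
    intro n
    induction n with
    | zero => exact hK
    | succ n ih => rw [hs]; exact hR2 n _ ih _ (hδ n).ne'
  have hanti : Antitone Ks := antitone_nat_of_succ_le fun n => by
    rw [hs]; exact hR1 n _ (hc n) _ (hδ n).ne'
  have hm : ∀ n, π K ≤ π (Ks n) + ∑ i ∈ Finset.range n, δ i := by
    intro n
    induction n with
    | zero => simp [Ks]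
    | succ n ih =>
      refine ih.trans ?_
      rw [Finset.sum_range_succ, hs]
      calc _ ≤ (π (R n (Ks n) (δ n)) + δ n) + ∑ i ∈ Finset.range n, δ i := by
            gcongr; exact hR5 n _ (hc n) _ (hδ n).ne'
        _ = _ := by ring
  have hcl : IsClosed (⋂ n, Ks n) := isClosed_iInter fun n => (hc n).isClosed
  have hKc : IsCompact (⋂ n, Ks n) := (hc 0).of_isClosed_subset hcl (iInter_subset _ 0)
  refine ⟨⋂ n, Ks n, iInter_subset _ 0, hKc, fun n => ?_, ?_⟩
  · have hsub : (⋂ n, Ks n) ⊆ Ks (n+1) := iInter_subset Ks (n+1)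
    constructor
    · have := (hR3 n _ (hc n) _ (hδ n).ne').inter_right hcl
      rw [← hs] at this
      convert this using 1
      ext x
      have := @hsub x
      simp only [mem_inter_iff] at *; tauto
    · have := (hR4 n _ (hc n) _ (hδ n).ne').inter_right hcl
      rw [← hs] at this
      convert this using 1
      ext x
      have := @hsub x
      simp only [mem_inter_iff, Set.mem_sdiff] at *; tauto
  · obtain ⟨V, hV, hVm, hKV, hVle⟩ := exists_open_approx π hKc hε2
    obtain ⟨n, hn⟩ := exists_subset_nhds_of_isCompact hanti.directed_ge hc (U := V)
      (fun x hx => hV.mem_nhds (hKV hx))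
    calc π K ≤ π (Ks n) + ∑ i ∈ Finset.range n, δ i := hm n
      _ ≤ (π (⋂ n, Ks n) + ε / 2) + ε / 2 := by
        gcongr
        · exact (measure_mono hn).trans hVle
        · exact (ENNReal.sum_le_tsum _).trans hδs.le
      _ = _ := by rw [add_assoc, ENNReal.add_halves]

end MeasurePart

lemma goodSet_countable {X : Type*} [MeasurableSpace X] [TopologicalSpace X] [BorelSpace X]
    [T2Space X] (π : Measure (X × X)) [IsFiniteMeasure π] [π.InnerRegular]
    {ι : Type*} [Countable ι] [Nonempty ι] (E : ι → Set (X × X)) (hE : ∀ n, GoodSet π (E n))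
    {G : Set (X × X)} (hG : MeasurableSet G) (hGc : π Gᶜ = 0) :
    ∃ K : ℕ → Set (X × X), (∀ n, K n ⊆ G) ∧ (∀ n, IsCompact (K n)) ∧
      (∀ n i, IsCompact (K n ∩ E i) ∧ IsCompact (K n \ E i)) ∧ π (⋃ n, K n) = π univ := by
  obtain ⟨e, he⟩ := exists_surjective_nat ι
  have hGu : π univ = π G := by rw [← measure_add_measure_compl hG, hGc, add_zero]
  have : ∀ n : ℕ, ∃ K ⊆ G, IsCompact K ∧ (∀ i, IsCompact (K ∩ E i) ∧ IsCompact (K \ E i)) ∧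
      π univ ≤ π K + (n : ℝ≥0∞)⁻¹ := by
    intro n
    have hε : (n : ℝ≥0∞)⁻¹ ≠ 0 := ENNReal.inv_ne_zero.2 (ENNReal.natCast_ne_top n)
    have hε2 : (n : ℝ≥0∞)⁻¹ / 2 ≠ 0 := (ENNReal.half_pos hε).ne'
    obtain ⟨K0, hK0G, hK0, hK0m⟩ := hG.exists_isCompact_lt_add (measure_ne_top π _) hε2
    obtain ⟨K, hKK, hK, hKE, hKm⟩ := goodSet_seq π (fun n => E (e n)) (fun n => hE _) hK0 hε2
    refine ⟨K, hKK.trans hK0G, hK, fun i => ?_, ?_⟩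
    · obtain ⟨j, rfl⟩ := he i
      exact hKE j
    · calc π univ = π G := hGu
        _ ≤ π K0 + (n : ℝ≥0∞)⁻¹ / 2 := hK0m.le
        _ ≤ (π K + (n : ℝ≥0∞)⁻¹ / 2) + (n : ℝ≥0∞)⁻¹ / 2 := by gcongr
        _ = _ := by rw [add_assoc, ENNReal.add_halves]
  choose K h1 h2 h3 h4 using this
  refine ⟨K, h1, h2, h3, le_antisymm (measure_mono (subset_univ _)) ?_⟩
  have ht : Tendsto (fun n : ℕ => π (⋃ n, K n) + (n : ℝ≥0∞)⁻¹) atTop (𝓝 (π (⋃ n, K n) + 0)) :=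
    tendsto_const_nhds.add ENNReal.tendsto_inv_nat_nhds_zero
  rw [add_zero] at ht
  refine ge_of_tendsto' ht fun n => (h4 n).trans ?_
  gcongr
  exact subset_iUnion K n

lemma null_compl_of_superset {Y : Type*} [MeasurableSpace Y] (π : Measure Y) [IsFiniteMeasure π]
    {S T : Set Y} (hS : π S = π univ) (hT : MeasurableSet T) (hST : S ⊆ T) : π Tᶜ = 0 := by
  rw [measure_compl hT (measure_ne_top _ _), ← hS, tsub_eq_zero_iff_le]
  exact measure_mono hST

/-- Let `X` be a Hausdorff space equipped with a lower semicontinuous metric `d` (not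
necessarily compatible with the topology), and let `π` be a (finite, inner regular,
i.e. Radon) measure on `X × X` concentrated on a `d`-cyclically monotonic set.  Then
`π` is concentrated on a set admitting a Borel `d`-extremal function: a Borel
`1`-`d`-Lipschitz function `f : X → ℝ` with `f x - f y = d x y` on that set. -/
theorem concentrated_on_borel_extremal
    {X : Type*} [TopologicalSpace X] [T2Space X] [MeasurableSpace X] [BorelSpace X]
    (d : X → X → ℝ)
    (hd_eq : ∀ x y, d x y = 0 ↔ x = y)
    (hd_symm : ∀ x y, d x y = d y x)
    (hd_tri : ∀ x y z, d x z ≤ d x y + d y z)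
    (hd_lsc : LowerSemicontinuous fun p : X × X => d p.1 p.2)
    (π : Measure (X × X)) [IsFiniteMeasure π] [π.InnerRegular]
    (hconc : ∃ C : Set (X × X), π Cᶜ = 0 ∧ IsCyclicallyMonotonic d C) :
    ∃ S : Set (X × X), π Sᶜ = 0 ∧
      ∃ f : X → ℝ, Measurable f ∧ (∀ x y, |f x - f y| ≤ d x y) ∧
        ∀ p ∈ S, f p.1 - f p.2 = d p.1 p.2 := by
  classical
  rcases isEmpty_or_nonempty X with hX | ⟨⟨z⟩⟩
  · exact ⟨univ, by simp, fun _ => 0, measurable_const, fun x => isEmptyElim x,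
      fun p => isEmptyElim p.1⟩
  obtain ⟨C, hC0, hC⟩ := hconc
  have hGm := (measurableSet_toMeasurable π Cᶜ).compl
  set G : Set (X × X) := (toMeasurable π Cᶜ)ᶜ with hGdef
  have hGC : G ⊆ C := by
    rw [hGdef, compl_subset_comm]; exact subset_toMeasurable _ _
  have hG0 : π Gᶜ = 0 := by rw [hGdef, compl_compl, measure_toMeasurable, hC0]
  have hmono : ∀ S ⊆ C, IsCyclicallyMonotonic d S := fun S hS n p hp σ =>
    hC n p (fun i => hS (hp i)) σ
  obtain ⟨A, hA, hsat⟩ := exists_saturating hGm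
  let E : ℚ ⊕ (ℕ ⊕ ℕ) → Set (X × X) := Sum.elim (fun q => {p | (q : ℝ) < d p.1 p.2})
    (Sum.elim (fun n => Prod.fst ⁻¹' (A n)) (fun n => Prod.snd ⁻¹' (A n)))
  have hE : ∀ i, GoodSet π (E i) := by
    rintro (q | n | n)
    · exact goodSet_open π (hd_lsc.isOpen_preimage (q : ℝ))
    · exact goodSet_preimage π continuous_fst measurable_fst (hA n)
    · exact goodSet_preimage π continuous_snd measurable_snd (hA n)
  obtain ⟨K, hKG, hKc, hKE, hKm⟩ := goodSet_countable π E hE hGm hG0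
  have hKlsc : ∀ n, LowerSemicontinuousOn (fun p : X × X => - d p.1 p.2) (K n) := by
    intro n p hp b hb
    obtain ⟨q, hq1, hq2⟩ := exists_rat_btwn (show d p.1 p.2 < -b by linarith)
    have hcl : IsClosed (K n ∩ E (Sum.inl q)) := (hKE n (Sum.inl q)).1.isClosed
    have hmem : (K n ∩ E (Sum.inl q))ᶜ ∈ 𝓝 p := hcl.isOpen_compl.mem_nhds
      (fun h => absurd (show (q : ℝ) < d p.1 p.2 from h.2) (not_lt.2 hq1.le))
    filter_upwards [mem_nhdsWithin_of_mem_nhds hmem, self_mem_nhdsWithin] with r hr hrK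
    have : ¬ ((q : ℝ) < d r.1 r.2) := fun h => hr ⟨hrK, h⟩
    linarith
  have hKS : (⋃ n, K n) ⊆ G := iUnion_subset hKG
  have hSm := hmono _ (hKS.trans hGC)
  obtain ⟨hf1, hf2, -⟩ := chainFun_spec hd_eq hd_symm hd_tri hSm z
  have hfm := chainFun_measurable hd_eq hd_symm hd_tri hd_lsc K hKc hKlsc hSm z
  obtain ⟨-, hg2, -⟩ := chainFun_spec hd_eq hd_symm hd_tri (hmono G hGC) z
  set f := chainFun d (⋃ n, K n) z
  set g := chainFun d G z
  let α : X → ℕ → Bool := fun x n => decide (x ∈ A n)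
  have hα : Measurable α := measurable_pi_iff.2 fun n => measurable_to_bool (by
    convert hA n using 1
    ext x; simp [α])
  let Φ : X × X → (ℕ → Bool) × (ℕ → Bool) := fun p => (α p.1, α p.2)
  have hΦ : Measurable Φ := (hα.comp measurable_fst).prodMk (hα.comp measurable_snd)
  have hdec : ∀ (L F : Set (X × X)), IsCompact (L ∩ F) → IsCompact (L \ F) →
      ContinuousOn (fun p => decide (p ∈ F)) L := by
    intro L F h1 h2 p hp
    refine ContinuousWithinAt.congr_of_eventuallyEq (f := fun _ => decide (p ∈ F))
      continuousWithinAt_const ?_ rfl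
    by_cases hpF : p ∈ F
    · have hmem : (L \ F)ᶜ ∈ 𝓝 p := h2.isClosed.isOpen_compl.mem_nhds (fun h => h.2 hpF)
      filter_upwards [mem_nhdsWithin_of_mem_nhds hmem, self_mem_nhdsWithin] with r hr hrL
      have : r ∈ F := by by_contra h; exact hr ⟨hrL, h⟩
      simp [this, hpF]
    · have hmem : (L ∩ F)ᶜ ∈ 𝓝 p := h1.isClosed.isOpen_compl.mem_nhds (fun h => hpF h.2)
      filter_upwards [mem_nhdsWithin_of_mem_nhds hmem, self_mem_nhdsWithin] with r hr hrL
      have : r ∉ F := fun h => hr ⟨hrL, h⟩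
      simp [this, hpF]
  have hΦK : ∀ n, ContinuousOn Φ (K n) := by
    intro n
    refine ContinuousOn.prodMk (continuousOn_pi.2 fun i => ?_) (continuousOn_pi.2 fun i => ?_)
    · exact hdec _ _ (hKE n (Sum.inr (Sum.inl i))).1 (hKE n (Sum.inr (Sum.inl i))).2
    · exact hdec _ _ (hKE n (Sum.inr (Sum.inr i))).1 (hKE n (Sum.inr (Sum.inr i))).2
  have hJ : MeasurableSet (⋃ n, Φ '' K n) := MeasurableSet.iUnion fun n =>
    ((hKc n).image_of_continuousOn (hΦK n)).isClosed.measurableSet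
  have hP : MeasurableSet (⋃ n, Prod.fst '' K n) := MeasurableSet.iUnion fun n =>
    ((hKc n).image continuous_fst).measurableSet
  have hQ : MeasurableSet (⋃ n, Prod.snd '' K n) := MeasurableSet.iUnion fun n =>
    ((hKc n).image continuous_snd).measurableSet
  have n1 := null_compl_of_superset π hKm (hΦ hJ) (fun p hp => by
    obtain ⟨n, hn⟩ := mem_iUnion.1 hp
    exact mem_iUnion.2 ⟨n, p, hn, rfl⟩)
  have n2 := null_compl_of_superset π hKm (measurable_fst hP) (fun p hp => by
    obtain ⟨n, hn⟩ := mem_iUnion.1 hp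
    exact mem_iUnion.2 ⟨n, p, hn, rfl⟩)
  have n3 := null_compl_of_superset π hKm (measurable_snd hQ) (fun p hp => by
    obtain ⟨n, hn⟩ := mem_iUnion.1 hp
    exact mem_iUnion.2 ⟨n, p, hn, rfl⟩)
  refine ⟨G ∩ (Φ ⁻¹' (⋃ n, Φ '' K n) ∩ (Prod.fst ⁻¹' (⋃ n, Prod.fst '' K n) ∩
    Prod.snd ⁻¹' (⋃ n, Prod.snd '' K n))), ?_, f, hfm, hf1, ?_⟩
  · simp only [compl_inter]
    exact measure_union_null hG0 (measure_union_null n1 (measure_union_null n2 n3))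
  rintro ⟨x, y⟩ ⟨hxyG, hxyJ, hx, hy⟩
  obtain ⟨n, ⟨x1, y1⟩, h1K, h1⟩ := mem_iUnion.1 hxyJ
  obtain ⟨n', ⟨x2, y2⟩, h2K, rfl : x2 = x⟩ := mem_iUnion.1 hx
  obtain ⟨n'', ⟨x3, y3⟩, h3K, rfl : y3 = y⟩ := mem_iUnion.1 hy
  have hαx : ∀ i, x1 ∈ A i ↔ x2 ∈ A i := fun i => by
    have := congrFun (congrArg Prod.fst h1) i
    simpa [Φ, α] using this
  have hαy : ∀ i, y1 ∈ A i ↔ y3 ∈ A i := fun i => by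
    have := congrFun (congrArg Prod.snd h1) i
    simpa [Φ, α] using this
  have hin : ∀ {n p}, p ∈ K n → p ∈ ⋃ n, K n := fun h => mem_iUnion.2 ⟨_, h⟩
  have hu1 : ∀ a b, (a, b) ∈ G → g b - f b ≤ g a - f a := fun a b hab => by
    have := hg2 _ hab
    have h2 := (le_abs_self _).trans (hf1 a b)
    simp only at this
    linarith
  have hu2 : ∀ {n a b}, (a, b) ∈ K n → g b - f b = g a - f a := fun {n a b} hab => by
    have := hg2 _ (hKG _ hab)
    have h2 := hf2 _ (hin hab)
    simp only at this h2
    linarith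
  have i1 := hu2 h1K
  have i2 := hu2 h2K
  have i3 := hu2 h3K
  have j1 := hu1 x1 y2 ((hsat x1 x2 y2 y2 hαx (fun _ => Iff.rfl)).2 (hKG _ h2K))
  have j2 := hu1 x2 y1 ((hsat x2 x2 y1 y3 (fun _ => Iff.rfl) hαy).2 hxyG)
  have j3 := hu1 x3 y1 ((hsat x3 x3 y1 y3 (fun _ => Iff.rfl) hαy).2 (hKG _ h3K))
  have j4 := hu1 x1 y3 ((hsat x1 x2 y3 y3 hαx (fun _ => Iff.rfl)).2 hxyG)
  have j5 := hg2 _ hxyG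
  simp only at j5 ⊢
  linarith
end

section
/- If a metric space M contains homeomorphic copies of the Euclidean sphere S^n for every n ∈ ℕ, then for every finite family f_1,…,f_n of continuous real functions on \widetilde{M} there exists (x,y) ∈ \widetilde{M} with f_i(x,y) = f_i(y,x) for all i. (Proof via the Borsuk–Ulam theorem.) -/
namespace BU

/-- Mod 2 coboundary on list cochains. -/
def cob {V : Type*} : (List V → ZMod 2) → List V → ZMod 2
  | _, [] => 0
  | φ, x :: l => φ l + cob (fun m => φ (x :: m)) l

/-- Mod 2 prism operator. -/
def prism {V : Type*} (a b : V → V) : (List V → ZMod 2) → List V → ZMod 2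
  | _, [] => 0
  | φ, x :: l => φ (a x :: b x :: l.map b) + prism a b (fun m => φ (a x :: m)) l

/-- Cup product of coboundaries of 0-cochains. -/
def W {V : Type*} : List (V → ZMod 2) → List V → ZMod 2
  | [], _ => 1
  | s :: ss, x :: y :: l => (s x + s y) * W ss (y :: l)
  | _ :: _, _ => 0

theorem z2 (a : ZMod 2) : a + a = 0 := CharTwo.add_self_eq_zero a

theorem cob_add {V : Type*} (l : List V) : ∀ φ ψ : List V → ZMod 2,
    cob (fun m => φ m + ψ m) l = cob φ l + cob ψ l := by
  induction l with
  | nil => intros; simp [cob]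
  | cons x l ih =>
    intro φ ψ
    simp only [cob, ih]; ring

theorem cob_mul {V : Type*} (c : ZMod 2) (l : List V) : ∀ φ : List V → ZMod 2,
    cob (fun m => c * φ m) l = c * cob φ l := by
  induction l with
  | nil => intros; simp [cob]
  | cons x l ih =>
    intro φ
    simp only [cob, ih]; ring

theorem cob_map {V : Type*} (g : V → V) (l : List V) : ∀ φ : List V → ZMod 2,
    cob (fun m => φ (m.map g)) l = cob φ (l.map g) := by
  induction l with
  | nil => intros; simp [cob]
  | cons x l ih =>
    intro φ
    simp only [cob, List.map_cons]
    rw [← ih]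

theorem prism_add {V : Type*} (a b : V → V) (l : List V) : ∀ φ ψ : List V → ZMod 2,
    prism a b (fun m => φ m + ψ m) l = prism a b φ l + prism a b ψ l := by
  induction l with
  | nil => intros; simp [prism]
  | cons x l ih =>
    intro φ ψ
    simp only [prism, ih]; ring

theorem prism_cob {V : Type*} (a b : V → V) (l : List V) : ∀ φ : List V → ZMod 2,
    prism a b (cob φ) l + cob (prism a b φ) l = φ (l.map b) + φ (l.map a) := by
  induction l with
  | nil => intro φ; simp [prism, cob, z2]
  | cons x l ih =>
    intro φ
    have h1 := ih (fun m => φ (a x :: m))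
    have e1 : (fun m => cob φ (a x :: m)) = fun m => φ m + cob (fun m => φ (a x :: m)) m := by
      funext m; simp [cob]
    have e2 : (fun m => prism a b φ (x :: m)) = fun m => (fun m => φ (a x :: b x :: m)) (m.map b)
        + prism a b (fun m => φ (a x :: m)) m := by
      funext m; simp [prism]
    simp only [prism, cob, List.map_cons]
    have e3 := cob_add l (fun m => (fun m => φ (a x :: b x :: m)) (m.map b))
      (prism a b (fun m => φ (a x :: m)))
    have e4 := cob_map b l (fun m => φ (a x :: b x :: m))
    have e5 := prism_add a b l φ (cob (fun m => φ (a x :: m)))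
    simp only at e3 e4 e5 h1
    rw [e3, e4, e5]
    generalize prism a b φ l = A at *
    generalize cob (fun m => φ (a x :: b x :: m)) (l.map b) = B at *
    generalize prism a b (cob fun m => φ (a x :: m)) l = C at *
    generalize cob (prism a b fun m => φ (a x :: m)) l = D at *
    linear_combination h1 + z2 A + z2 B + z2 (φ (a x :: l.map b))

theorem prism_congr {V : Type*} (a b : V → V) (l : List V) : ∀ φ ψ : List V → ZMod 2,
    (∀ m : List V, m.length = l.length + 1 → (∀ y ∈ m, ∃ x ∈ l, y = a x ∨ y = b x) → φ m = ψ m) →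
    prism a b φ l = prism a b ψ l := by
  induction l with
  | nil => intros; simp [prism]
  | cons x l ih =>
    intro φ ψ h
    simp only [prism]
    congr 1
    · apply h
      · simp
      · intro y hy
        simp only [List.mem_cons, List.mem_map] at hy
        rcases hy with rfl | rfl | ⟨z, hz, rfl⟩
        · exact ⟨x, by simp, Or.inl rfl⟩
        · exact ⟨x, by simp, Or.inr rfl⟩
        · exact ⟨z, by simp [hz], Or.inr rfl⟩
    · apply ih
      intro m hm hy
      apply h
      · simp [hm]
      · intro y hy'
        rcases List.mem_cons.1 hy' with rfl | hy'
        · exact ⟨x, by simp, Or.inl rfl⟩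
        · obtain ⟨z, hz, h⟩ := hy y hy'
          exact ⟨z, by simp [hz], h⟩

theorem cob_W {V : Type*} (ss : List (V → ZMod 2)) : ∀ l : List V, l.length = ss.length + 2 →
    cob (W ss) l = 0 := by
  induction ss with
  | nil =>
    intro l hl
    match l, hl with
    | [x, y], _ => simp [cob, W, z2]
  | cons s ss ih =>
    intro l hl
    match l, hl with
    | x :: y :: z :: l, hl =>
      have h1 := ih (y :: z :: l) (by simpa using hl)
      have e : (fun m => W (s :: ss) (x :: y :: m)) = fun m => (s x + s y) * W ss (y :: m) := by
        funext m; simp [W]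
      rw [cob, cob, e, cob_mul]
      rw [cob] at h1
      simp only [W]
      linear_combination (s x + s y) * h1 + z2 (s z * W ss (z :: l))

/-- The primitive of the cup product. -/
def U {V : Type*} (s : V → ZMod 2) (ss : List (V → ZMod 2)) : List V → ZMod 2
  | [] => 0
  | x :: l => s x * W ss (x :: l)

theorem cob_U {V : Type*} (s : V → ZMod 2) (ss : List (V → ZMod 2)) (l : List V)
    (hl : l.length = ss.length + 2) : cob (U s ss) l = W (s :: ss) l := by
  match l, hl with
  | x :: y :: l, hl =>
    have h := cob_W ss (x :: y :: l) hl
    rw [cob] at h ⊢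
    have e : (fun m => U s ss (x :: m)) = fun m => s x * W ss (x :: m) := by
      funext m; simp [U]
    rw [e, cob_mul]
    simp only [U, W]
    linear_combination s x * h - z2 (s x * W ss (y :: l)) + s x * z2 (W ss (y :: l)) - z2 (s x * W ss (y :: l)) 
     + z2 (s x * W ss (y :: l)) - s x * z2 (W ss (y :: l))

theorem W_neg {V : Type*} [Neg V] (ss : List (V → ZMod 2)) : ∀ l : List V,
    (∀ s ∈ ss, ∀ x ∈ l, s (-x) = s x + 1) → W ss (l.map (fun x => -x)) = W ss l := by
  induction ss with
  | nil => intros; simp [W]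
  | cons s ss ih =>
    intro l h
    match l with
    | [] => simp [W]
    | [x] => simp [W]
    | x :: y :: l =>
      have := ih (y :: l) (fun s hs x hx => h s (by simp [hs]) x (by simp at hx ⊢; tauto))
      simp only [List.map_cons, W] at this ⊢
      rw [this, h s (by simp) x (by simp), h s (by simp) y (by simp)]
      linear_combination z2 1 * W ss (y :: l)

theorem U_neg {V : Type*} [Neg V] (s : V → ZMod 2) (ss : List (V → ZMod 2)) (l : List V)
    (hl : l ≠ []) (h : ∀ t ∈ s :: ss, ∀ x ∈ l, t (-x) = t x + 1) :
    U s ss l + U s ss (l.map (fun x => -x)) = W ss l := by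
  match l, hl with
  | x :: l, _ =>
    have := W_neg ss (x :: l) (fun t ht => h t (by simp [ht]))
    simp only [List.map_cons, U] at this ⊢
    rw [this, h s (by simp) x (by simp)]
    linear_combination z2 (s x * W ss (x :: l))

theorem W_zero {V : Type*} (ss : List (V → ZMod 2)) : ∀ l : List V, l.length = ss.length + 1 →
    (∃ s ∈ ss, ∀ x ∈ l, ∀ y ∈ l, s x = s y) → W ss l = 0 := by
  induction ss with
  | nil => rintro l - ⟨s, hs, -⟩; simp at hs
  | cons t ss ih =>
    rintro l hl ⟨s, hs, h⟩
    match l, hl with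
    | x :: y :: l, hl =>
      simp only [W]
      rcases List.mem_cons.1 hs with rfl | hs
      · rw [h x (by simp) y (by simp), z2, zero_mul]
      · rw [ih (y :: l) (by simpa using hl) ⟨s, hs, fun a ha b hb =>
          h a (List.mem_cons_of_mem _ ha) b (List.mem_cons_of_mem _ hb)⟩, mul_zero]

/-- Iterated prism. -/
theorem exists_prism {V : Type*} (H : ℕ → V → V) (m : ℕ) :
    ∃ D : (List V → ZMod 2) → List V → ZMod 2,
      (∀ φ ψ l, D (fun m => φ m + ψ m) l = D φ l + D ψ l) ∧
      (∀ φ l, D (cob φ) l + cob (D φ) l = φ (l.map (H m)) + φ (l.map (H 0))) ∧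
      (∀ φ ψ l, (∀ k : List V, k.length = l.length + 1 →
        (∃ j < m, ∀ y ∈ k, ∃ x ∈ l, y = H j x ∨ y = H (j + 1) x) → φ k = ψ k) → D φ l = D ψ l) := by
  induction m with
  | zero =>
    have h0 : ∀ l : List V, cob (fun _ => 0) l = 0 := by
      intro l
      induction l with
      | nil => rfl
      | cons x l ih => simp [cob, ih]
    exact ⟨fun _ _ => 0, by simp, by intro φ l; simp [h0, z2], by simp⟩
  | succ m ih =>
    obtain ⟨D, h1, h2, h3⟩ := ih
    refine ⟨fun φ l => D φ l + prism (H m) (H (m + 1)) φ l, ?_, ?_, ?_⟩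
    · intro φ ψ l
      simp only
      rw [h1, prism_add]; ring
    · intro φ l
      have := prism_cob (H m) (H (m + 1)) l φ
      rw [cob_add]
      linear_combination this + h2 φ l + z2 (φ (l.map (H m)))
    · intro φ ψ l h
      simp only
      rw [h3 φ ψ l, prism_congr _ _ l φ ψ]
      · intro k hk hy
        exact h k hk ⟨m, by omega, hy⟩
      · rintro k hk ⟨j, hj, hy⟩
        exact h k hk ⟨j, by omega, hy⟩

/-- Small simplices in the `k`-dimensional cross-polytope sphere. -/
def Good (N k : ℕ) (δ : ℝ) (l : List (Fin N → ℝ)) : Prop :=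
  l.length = k + 1 ∧ (∀ x ∈ l, ∑ i, |x i| = 1 ∧ ∀ i : Fin N, k < i → x i = 0) ∧
    ∀ x ∈ l, ∀ y ∈ l, dist x y < δ

theorem Good.neg {N k : ℕ} {δ : ℝ} {l : List (Fin N → ℝ)} (h : Good N k δ l) :
    Good N k δ (l.map (fun x => -x)) := by
  obtain ⟨h1, h2, h3⟩ := h
  refine ⟨by simpa using h1, ?_, ?_⟩
  · intro x hx
    obtain ⟨y, hy, rfl⟩ := List.mem_map.1 hx
    have := h2 y hy
    simpa using this
  · intro x hx x' hx'
    obtain ⟨y, hy, rfl⟩ := List.mem_map.1 hx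
    obtain ⟨y', hy', rfl⟩ := List.mem_map.1 hx'
    rw [dist_neg_neg]
    exact h3 y hy y' hy'

theorem good_step {N k : ℕ} (hk : k + 1 < N) {δ : ℝ} (hδ : 0 < δ) (m : ℕ) (hm : 2 / (m : ℝ) < δ / 2)
    (l l' : List (Fin N → ℝ)) (hl : Good N k (δ / 2) l) (hl' : l'.length = l.length + 1)
    (H : ℕ → (Fin N → ℝ) → (Fin N → ℝ))
    (hH : ∀ j x, H j x = (1 - (j : ℝ) / m) • x + ((j : ℝ) / m) • Pi.single ⟨k + 1, hk⟩ (1 : ℝ))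
    (j : ℕ) (hj : j < m)
    (h : ∀ y ∈ l', ∃ x ∈ l, y = H j x ∨ y = H (j + 1) x) : Good N (k + 1) δ l' := by
  obtain ⟨h1, h2, h3⟩ := hl
  have hm0 : (0 : ℝ) < m := by exact_mod_cast (by omega : 0 < m)
  have key : ∀ i : ℕ, i ≤ m → ∀ x ∈ l, ∑ p, |H i x p| = 1 ∧ ∀ p : Fin N, k + 1 < p → H i x p = 0 := by
    intro i hi x hx
    obtain ⟨hx1, hx2⟩ := h2 x hx
    have ht0 : (0 : ℝ) ≤ (i : ℝ) / m := by positivity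
    have ht1 : (i : ℝ) / m ≤ 1 := by
      rw [div_le_one hm0]; exact_mod_cast hi
    rw [hH]
    generalize (i : ℝ) / m = t at ht0 ht1
    constructor
    · have : ∀ p, |((1 - t) • x + t • (Pi.single ⟨k + 1, hk⟩ (1 : ℝ) : Fin N → ℝ)) p| =
          (1 - t) * |x p| + t * (Pi.single ⟨k + 1, hk⟩ (1 : ℝ) : Fin N → ℝ) p := by
        intro p
        by_cases hp : p = ⟨k + 1, hk⟩
        · subst hp
          have : x ⟨k + 1, hk⟩ = 0 := hx2 _ (by simp)
          simp [this, abs_of_nonneg ht0]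
        · simp [Pi.single_eq_of_ne hp, abs_mul, abs_of_nonneg (sub_nonneg.2 ht1)]
      simp_rw [this]
      rw [Finset.sum_add_distrib, ← Finset.mul_sum, ← Finset.mul_sum, hx1]
      simp
    · intro p hp
      have hne : p ≠ ⟨k + 1, hk⟩ := by
        rintro rfl; simp at hp
      simp [Pi.single_eq_of_ne hne, hx2 p (by omega)]
  have norm_le : ∀ x : Fin N → ℝ, ∑ i, |x i| = 1 → ‖x‖ ≤ 1 := by
    intro x hx
    rw [pi_norm_le_iff_of_nonneg zero_le_one]
    intro i
    rw [← hx, Real.norm_eq_abs]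
    exact Finset.single_le_sum (f := fun i => |x i|) (fun _ _ => abs_nonneg _) (Finset.mem_univ i)
  have contr : ∀ i : ℕ, i ≤ m → ∀ x y, dist (H i x) (H i y) ≤ dist x y := by
    intro i hi x y
    have ht0 : (0 : ℝ) ≤ (i : ℝ) / m := by positivity
    have ht1 : (i : ℝ) / m ≤ 1 := by
      rw [div_le_one hm0]; exact_mod_cast hi
    rw [hH, hH, dist_add_right, dist_smul₀, Real.norm_eq_abs, abs_of_nonneg (sub_nonneg.2 ht1)]
    nlinarith [dist_nonneg (x := x) (y := y)]
  have step : ∀ x ∈ l, dist (H j x) (H (j + 1) x) < δ / 2 := by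
    intro x hx
    refine lt_of_le_of_lt ?_ hm
    have : H j x - H (j + 1) x = (1 / (m : ℝ)) • (x - Pi.single ⟨k + 1, hk⟩ (1 : ℝ)) := by
      rw [hH, hH]
      ext p
      simp only [Pi.add_apply, Pi.sub_apply, Pi.smul_apply, smul_eq_mul]
      push_cast
      ring
    rw [dist_eq_norm, this, norm_smul, Real.norm_eq_abs, abs_of_nonneg (by positivity)]
    have hn : ‖x - Pi.single ⟨k + 1, hk⟩ (1 : ℝ)‖ ≤ 2 := by
      refine (norm_sub_le _ _).trans ?_
      have h1 := norm_le x (h2 x hx).1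
      have h2 : ‖(Pi.single ⟨k + 1, hk⟩ (1 : ℝ) : Fin N → ℝ)‖ ≤ 1 := by
        apply norm_le
        rw [Finset.sum_eq_single ⟨k + 1, hk⟩]
        · simp
        · intro b _ hb; simp [Pi.single_eq_of_ne hb]
        · simp
      linarith
    calc 1 / (m : ℝ) * ‖x - Pi.single ⟨k + 1, hk⟩ (1 : ℝ)‖ ≤ 1 / (m : ℝ) * 2 := by gcongr
      _ = 2 / m := by ring
  refine ⟨by omega, ?_, ?_⟩
  · intro y hy
    obtain ⟨x, hx, rfl | rfl⟩ := h y hy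
    · exact key j (by omega) x hx
    · exact key (j + 1) (by omega) x hx
  · intro y hy y' hy'
    obtain ⟨x, hx, hxy⟩ := h y hy
    obtain ⟨x', hx', hxy'⟩ := h y' hy'
    have d := h3 x hx x' hx'
    have c0 := contr j (by omega) x x'
    have c1 := contr (j + 1) (by omega) x x'
    have s := step x hx
    rcases hxy with rfl | rfl <;> rcases hxy' with rfl | rfl
    · linarith
    · have := dist_triangle (H j x) (H (j + 1) x) (H (j + 1) x')
      linarith
    · have := dist_triangle (H (j + 1) x) (H j x) (H j x')
      rw [dist_comm (H (j + 1) x) (H j x)] at this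
      linarith
    · linarith

theorem main_chain (N k : ℕ) : k < N → ∀ δ : ℝ, 0 < δ →
    ∃ L : (List (Fin N → ℝ) → ZMod 2) → ZMod 2,
      (∀ φ ψ, L (fun l => φ l + ψ l) = L φ + L ψ) ∧
      (∀ φ ψ, (∀ l, Good N k δ l → φ l = ψ l) → L φ = L ψ) ∧
      (∀ φ, L (cob φ) = L (fun l => cob φ (l.map (fun x => -x)))) ∧
      (∀ ss : List ((Fin N → ℝ) → ZMod 2), ss.length = k →
        (∀ s ∈ ss, ∀ x, ∑ i, |x i| = 1 → s (-x) = s x + 1) → L (W ss) = 1) := by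
  induction k with
  | zero =>
    intro hk δ hδ
    refine ⟨fun φ => φ [Pi.single ⟨0, hk⟩ 1], by simp, ?_, by simp [cob], ?_⟩
    · intro φ ψ h
      apply h
      refine ⟨by simp, ?_, ?_⟩
      · intro x hx
        rw [List.mem_singleton] at hx
        subst hx
        constructor
        · rw [Finset.sum_eq_single ⟨0, hk⟩]
          · simp
          · intro b _ hb; simp [Pi.single_eq_of_ne hb]
          · simp
        · intro i hi
          apply Pi.single_eq_of_ne
          rintro rfl
          simp at hi
      · intro x hx y hy
        rw [List.mem_singleton] at hx hy
        subst hx; subst hy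
        simpa using hδ
    · intro ss hss _
      rw [List.length_eq_zero_iff.1 hss]
      simp [W]
  | succ k ih =>
    intro hk δ hδ
    obtain ⟨L, L1, L2, L3, L4⟩ := ih (by omega) (δ / 2) (by positivity)
    obtain ⟨m, hm⟩ := exists_nat_gt (2 / (δ / 2))
    have hm0 : (0 : ℝ) < m := lt_trans (by positivity) hm
    have hm2 : 2 / (m : ℝ) < δ / 2 := by
      rw [div_lt_iff₀ (by positivity)] at hm ⊢
      linarith
    let H : ℕ → (Fin N → ℝ) → (Fin N → ℝ) := fun j x =>
      (1 - (j : ℝ) / m) • x + ((j : ℝ) / m) • Pi.single ⟨k + 1, hk⟩ (1 : ℝ)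
    have hH0 : H 0 = fun x => x := by funext x; simp [H]
    have hHm : H m = fun _ => Pi.single ⟨k + 1, hk⟩ (1 : ℝ) := by
      funext x; simp [H, div_self hm0.ne']
    obtain ⟨D, D1, D2, D3⟩ := exists_prism H m
    have bd : ∀ φ, L (D (cob φ)) + L (fun l => D (cob φ) (l.map (fun x => -x))) =
        L φ + L (fun l => φ (l.map (fun x => -x))) := by
      intro φ
      have e : D (cob φ) = fun l => cob (D φ) l + (φ (l.map (H m)) + φ l) := by
        funext l
        have := D2 φ l
        rw [hH0, List.map_id'] at this
        linear_combination this - z2 (cob (D φ) l) 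
      have hc : ∀ l : List (Fin N → ℝ), (l.map (fun x => -x)).map (H m) = l.map (H m) := by
        intro l
        rw [List.map_map, hHm]; rfl
      rw [e]
      simp only [hc]
      rw [L1, L1, L1, L1, ← L3]
      linear_combination z2 (L (cob (D φ))) + z2 (L fun l => φ (l.map (H m)))
    refine ⟨fun φ => L (D φ) + L (fun l => D φ (l.map (fun x => -x))), ?_, ?_, ?_, ?_⟩
    · intro φ ψ
      have e : D (fun l => φ l + ψ l) = fun l => D φ l + D ψ l := funext fun l => D1 φ ψ l
      simp only [e, L1]
      ring
    · intro φ ψ h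
      have hD : ∀ l, Good N k (δ / 2) l → D φ l = D ψ l := by
        intro l hl
        apply D3
        rintro l' hl' ⟨j, hj, hy⟩
        exact h l' (good_step hk hδ m hm2 l l' hl hl' H (fun _ _ => rfl) j hj hy)
      simp only
      rw [L2 (D φ) (D ψ) hD, L2 (fun l => D φ (l.map (fun x => -x)))
        (fun l => D ψ (l.map (fun x => -x))) (fun l hl => hD _ hl.neg)]
    · intro φ
      have e : (fun l => cob φ (l.map (fun x => -x))) = cob (fun l => φ (l.map (fun x => -x))) :=
        funext fun l => (cob_map _ l φ).symm
      simp only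
      rw [e, bd, bd]
      have : (fun l : List (Fin N → ℝ) => φ ((l.map (fun x => -x)).map (fun x => -x))) = φ := by
        funext l; simp [Function.comp_def]
      rw [this, add_comm]
    · intro ss hss h
      match ss, hss with
      | s :: ss, hss =>
        have hss' : ss.length = k := by simpa using hss
        have hD : ∀ l, Good N k (δ / 2) l → D (W (s :: ss)) l = D (cob (U s ss)) l := by
          intro l hl
          apply D3
          intro l' hl' _
          rw [cob_U]
          rw [hl', hl.1, hss']
        simp only
        rw [L2 _ _ hD, L2 (fun l => D (W (s :: ss)) (l.map (fun x => -x)))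
          (fun l => D (cob (U s ss)) (l.map (fun x => -x))) (fun l hl => hD _ hl.neg), bd, ← L1]
        rw [← L4 ss hss' (fun t ht => h t (by simp [ht]))]
        apply L2
        intro l hl
        apply U_neg
        · intro h0
          have := hl.1
          simp [h0] at this
        · intro t ht x hx
          exact h t ht x (hl.2.1 x hx).1

theorem exists_sign (N : ℕ) : ∃ σ : (Fin N → ℝ) → ZMod 2, ∀ x, x ≠ 0 → σ (-x) = σ x + 1 := by
  classical
  refine ⟨fun x => if 0 < toLex x then 1 else 0, fun x hx => ?_⟩
  have hx' : toLex x ≠ 0 := hx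
  have e : toLex (-x) = - toLex x := rfl
  simp only [e, Left.neg_pos_iff]
  split_ifs with h1 h2 h2
  · exact absurd h2 (lt_asymm h1)
  · simp
  · simp [z2]
  · exact absurd (lt_or_gt_of_ne hx') (not_or.2 ⟨h1, h2⟩)

theorem borsuk_ulam (n : ℕ) (G : (Fin (n + 1) → ℝ) → (Fin n → ℝ))
    (hG : ContinuousOn G {x | ∑ i, |x i| = 1})
    (hodd : ∀ x, ∑ i, |x i| = 1 → G (-x) = - G x) :
    ∃ x, ∑ i, |x i| = 1 ∧ G x = 0 := by
  classical
  by_contra! hne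
  set X : Set (Fin (n + 1) → ℝ) := {x | ∑ i, |x i| = 1} with hX
  have hXc : IsCompact X := by
    apply Metric.isCompact_of_isClosed_isBounded
    · exact isClosed_eq (by fun_prop) continuous_const
    · rw [isBounded_iff_forall_norm_le]
      refine ⟨1, fun x hx => ?_⟩
      rw [pi_norm_le_iff_of_nonneg zero_le_one]
      intro i
      rw [← (show ∑ i, |x i| = 1 from hx), Real.norm_eq_abs]
      exact Finset.single_le_sum (f := fun i => |x i|) (fun _ _ => abs_nonneg _) (Finset.mem_univ i)
  have hXne : X.Nonempty := by
    refine ⟨Pi.single 0 1, ?_⟩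
    show ∑ i, _ = _
    rw [Finset.sum_eq_single 0]
    · simp
    · intro b _ hb; simp [Pi.single_eq_of_ne hb]
    · simp
  obtain ⟨x₀, hx₀, hmin⟩ := hXc.exists_isMinOn hXne hG.norm
  set ε := ‖G x₀‖ with hε
  have hε0 : 0 < ε := norm_pos_iff.2 (hne x₀ hx₀)
  have huc := hXc.uniformContinuousOn_of_continuous hG
  obtain ⟨δ, hδ, hδ'⟩ := Metric.uniformContinuousOn_iff.1 huc ε hε0
  obtain ⟨σ, hσ⟩ := exists_sign (n + 1)
  obtain ⟨L, L1, L2, -, L4⟩ := main_chain (n + 1) n (by omega) δ hδ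
  let s : Fin n → (Fin (n + 1) → ℝ) → ZMod 2 := fun i x =>
    if 0 < G x i then 1 else if G x i < 0 then 0 else σ x
  have h1 : L (W (List.ofFn s)) = 1 := by
    apply L4
    · simp
    · intro t ht x hx
      obtain ⟨i, rfl⟩ := (List.mem_ofFn' _ _).1 ht
      have hx0 : x ≠ 0 := by
        rintro rfl; simp at hx
      simp only [s, hodd x hx, Pi.neg_apply, Left.neg_pos_iff, Left.neg_neg_iff]
      rcases lt_trichotomy (G x i) 0 with h | h | h
      · simp [h, not_lt_of_gt h]
      · simp [h, hσ x hx0]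
      · simp [h, not_lt_of_gt h, z2]
  have h0 : L (fun _ => 0) = 0 := by
    have := L1 (fun _ => 0) (fun _ => 0)
    simpa using this
  have h2 : L (W (List.ofFn s)) = L (fun _ => 0) := by
    apply L2
    intro l hl
    apply W_zero
    · simpa using hl.1
    · match l, hl with
      | x :: l, hl =>
        have hxX : x ∈ X := (hl.2.1 x (by simp)).1
        have hb : ∃ i, ε ≤ |G x i| := by
          by_contra! hb
          have h3 : ‖G x‖ < ε := (pi_norm_lt_iff hε0).2 hb
          have h4 : ε ≤ ‖G x‖ := hmin hxX
          linarith
        obtain ⟨i, hi⟩ := hb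
        refine ⟨s i, (List.mem_ofFn' _ _).2 ⟨i, rfl⟩, ?_⟩
        have hs : ∀ y ∈ x :: l, s i y = s i x := by
          intro y hy
          have h5 := hδ' y (hl.2.1 y hy).1 x hxX (hl.2.2 y hy x (by simp))
          have h6 : |G y i - G x i| < ε := lt_of_le_of_lt (dist_le_pi_dist (G y) (G x) i) h5
          rw [abs_lt] at h6
          rcases le_abs.1 hi with h | h
          · have a : 0 < G x i := by linarith
            have b : 0 < G y i := by linarith
            simp [s, a, b]
          · have a : G x i < 0 := by linarith
            have b : G y i < 0 := by linarith
            simp [s, a, b, not_lt_of_gt a, not_lt_of_gt b]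
        intro y hy z hz
        rw [hs y hy, hs z hz]
  rw [h1, h0] at h2
  exact one_ne_zero h2

end BU


/-- If a metric space `M` contains homeomorphic (topologically embedded) copies of the
Euclidean sphere `S^n` for every `n`, then for every finite family `f_1, …, f_n` of
continuous real functions on `\widetilde{M} = {(x,y) : x ≠ y}` there exists
`(x,y) ∈ \widetilde{M}` with `f_i(x,y) = f_i(y,x)` for all `i`. -/
theorem exists_symmetric_point_of_spheres {M : Type*} [MetricSpace M]
    (hsph : ∀ n : ℕ, ∃ g : (Metric.sphere (0 : EuclideanSpace ℝ (Fin (n + 1))) 1) → M,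
      Topology.IsEmbedding g) :
    ∀ (n : ℕ) (f : Fin n → ({p : M × M // p.1 ≠ p.2} → ℝ)),
      (∀ i, Continuous (f i)) →
      ∃ p : {p : M × M // p.1 ≠ p.2},
        ∀ i, f i p = f i ⟨(p.1.2, p.1.1), Ne.symm p.2⟩ := by
  intro n f hf
  obtain ⟨g, hg⟩ := hsph n
  have hne : ∀ x : Fin (n + 1) → ℝ, ∑ i, |x i| = 1 → WithLp.toLp 2 x ≠ 0 := by
    intro x hx h
    have h' : x = 0 := by simpa using h
    subst h'
    simp at hx
  let X : Set (Fin (n + 1) → ℝ) := {x | ∑ i, |x i| = 1}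
  let r : X → Metric.sphere (0 : EuclideanSpace ℝ (Fin (n + 1))) 1 := fun x =>
    ⟨‖WithLp.toLp 2 x.1‖⁻¹ • WithLp.toLp 2 x.1, by
      rw [mem_sphere_zero_iff_norm, norm_smul, norm_inv, norm_norm,
        inv_mul_cancel₀ (norm_ne_zero_iff.2 (hne x.1 x.2))]⟩
  have hr : Continuous r := by
    have hc : Continuous fun x : X => (WithLp.toLp 2 x.1 : EuclideanSpace ℝ (Fin (n + 1))) :=
      (PiLp.continuous_toLp 2 _).comp continuous_subtype_val
    exact Continuous.subtype_mk
      ((hc.norm.inv₀ (fun x => norm_ne_zero_iff.2 (hne x.1 x.2))).smul hc) _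
  have hnegX : ∀ x ∈ X, -x ∈ X := by
    intro x hx
    simpa [X] using hx
  have hsne : ∀ u : Metric.sphere (0 : EuclideanSpace ℝ (Fin (n + 1))) 1, u ≠ -u := by
    intro u
    exact ne_neg_of_mem_unit_sphere ℝ u
  let q : Metric.sphere (0 : EuclideanSpace ℝ (Fin (n + 1))) 1 → {p : M × M // p.1 ≠ p.2} :=
    fun u => ⟨(g u, g (-u)), fun h => hsne u (hg.injective h)⟩
  have hq : Continuous q := by
    apply Continuous.subtype_mk
    exact hg.continuous.prodMk (hg.continuous.comp continuous_neg)
  let F : Metric.sphere (0 : EuclideanSpace ℝ (Fin (n + 1))) 1 → Fin n → ℝ :=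
    fun u i => f i (q u) - f i (q (-u))
  have hF : Continuous F := by
    apply continuous_pi
    intro i
    exact ((hf i).comp hq).sub ((hf i).comp (hq.comp continuous_neg))
  classical
  let G : (Fin (n + 1) → ℝ) → (Fin n → ℝ) := fun x => if hx : x ∈ X then F (r ⟨x, hx⟩) else 0
  have hGX : ∀ x (hx : x ∈ X), G x = F (r ⟨x, hx⟩) := fun x hx => dif_pos hx
  obtain ⟨x, hx, hx0⟩ := BU.borsuk_ulam n G (by
      rw [continuousOn_iff_continuous_domRestrict]
      have : Set.domRestrict X G = F ∘ r := by
        funext x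
        exact hGX x.1 x.2
      show Continuous (Set.domRestrict X G)
      rw [this]
      exact hF.comp hr) (by
      intro x hx
      rw [hGX x hx, hGX (-x) (hnegX x hx)]
      have : r ⟨-x, hnegX x hx⟩ = - r ⟨x, hx⟩ := by
        apply Subtype.ext
        simp [r]
      rw [this]
      funext i
      simp [F])
  rw [hGX x hx] at hx0
  refine ⟨q (r ⟨x, hx⟩), fun i => ?_⟩
  have h := congrFun hx0 i
  have e : q (-(r ⟨x, hx⟩)) = ⟨((q (r ⟨x, hx⟩)).1.2, (q (r ⟨x, hx⟩)).1.1),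
      Ne.symm (q (r ⟨x, hx⟩)).2⟩ := by
    apply Subtype.ext
    simp [q]
  rw [← e]
  exact sub_eq_zero.1 h
end
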